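/- Let G be a countable abelian group acting on a probability space (X, 𝓑, μ), let A ⊆ G be any (not necessarily finite) subset, let B ∈ 𝓑 with μ(B) > 0, let 0 < δ < 1, and let j ≤ k be positive integers. Then sup { c_δ(A′, B)^{1/k} : A′ ⊆ A^k, A′ finite } ≤ (1-δ)^{-1/j} · (μ(A^j B)/μ(B))^{1/j}. -/

import Mathlib

open Filter MeasureTheory Pointwise ENNReal

/-- The `δ`-heavy magnification ratio
`c_δ(A, B) = inf { μ(A B') / μ(B') : B' ⊆ B measurable, μ(B') ≥ δ·μ(B) }`,
where `A B' = ⋃_{a ∈ A} a • B'`. -/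
noncomputable def magRatioHeavy {G X : Type*} [SMul G X] [MeasurableSpace X]
    (μ : Measure X) (δ : ℝ) (A : Set G) (B : Set X) : ℝ≥0∞ :=
  sInf {r : ℝ≥0∞ | ∃ B' : Set X, B' ⊆ B ∧ MeasurableSet B' ∧
    ENNReal.ofReal δ * μ B ≤ μ B' ∧ r = μ (A • B') / μ B'}

section Helpers

/-- Layer-cake counting for finitely many sets. -/
lemma layer_sum {X ι : Type*} [MeasurableSpace X] (μ : Measure X) [IsFiniteMeasure μ]
    (A : Finset ι) (E : ι → Set X) (hE : ∀ a, MeasurableSet (E a)) :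
    (∀ t : ℕ, MeasurableSet {x | ∃ T ⊆ A, T.card = t ∧ ∀ a ∈ T, x ∈ E a}) ∧
    ∑ t ∈ Finset.Icc 1 A.card, μ.real {x | ∃ T ⊆ A, T.card = t ∧ ∀ a ∈ T, x ∈ E a} =
      ∑ a ∈ A, μ.real (E a) := by
  classical
  have hm : ∀ t : ℕ, MeasurableSet {x | ∃ T ⊆ A, T.card = t ∧ ∀ a ∈ T, x ∈ E a} := by
    intro t
    have : {x | ∃ T ⊆ A, T.card = t ∧ ∀ a ∈ T, x ∈ E a} =
        ⋃ T ∈ A.powersetCard t, ⋂ a ∈ T, E a := by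
      ext x
      simp [Finset.mem_powersetCard, and_assoc]
    rw [this]
    exact Finset.measurableSet_biUnion _ fun T _ =>
      Finset.measurableSet_biInter _ fun a _ => hE a
  refine ⟨hm, ?_⟩
  have h1 : ∀ S : Set X, MeasurableSet S → μ.real S = ∫ x, S.indicator (1 : X → ℝ) x ∂μ := by
    intro S hS
    rw [integral_indicator_one hS]
  have hi : ∀ S : Set X, MeasurableSet S → Integrable (S.indicator (1 : X → ℝ)) μ := by
    intro S hS
    exact (integrable_const (1 : ℝ)).indicator hS
  rw [Finset.sum_congr rfl fun t _ => h1 _ (hm t), Finset.sum_congr rfl fun a _ => h1 _ (hE a),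
    ← integral_finsetSum _ fun t _ => hi _ (hm t), ← integral_finsetSum _ fun a _ => hi _ (hE a)]
  congr 1
  ext x
  simp only [Set.indicator_apply, Pi.one_apply, Finset.sum_boole]
  congr 1
  have : (Finset.Icc 1 A.card).filter
      (fun t => x ∈ {x | ∃ T ⊆ A, T.card = t ∧ ∀ a ∈ T, x ∈ E a}) =
      Finset.Icc 1 (A.filter fun a => x ∈ E a).card := by
    ext t
    simp only [Finset.mem_filter, Finset.mem_Icc, Set.mem_setOf_eq]
    constructor
    · rintro ⟨⟨h1, h2⟩, T, hT, rfl, hx⟩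
      refine ⟨h1, Finset.card_le_card fun a ha => ?_⟩
      exact Finset.mem_filter.2 ⟨hT ha, hx a ha⟩
    · rintro ⟨h1, h2⟩
      obtain ⟨T, hT, hc⟩ := Finset.exists_subset_card_eq h2
      refine ⟨⟨h1, h2.trans (Finset.card_filter_le _ _)⟩, T,
        hT.trans (Finset.filter_subset _ _), hc, fun a ha => (Finset.mem_filter.1 (hT ha)).2⟩
  rw [this]
  simp

variable {G X : Type*} [CommGroup G] [MulAction G X] [MeasurableSpace X]

lemma meas_smul (hmeas : ∀ g : G, Measurable (fun x : X => g • x)) (g : G) {S : Set X}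
    (hS : MeasurableSet S) : MeasurableSet (g • S) := by
  have : g • S = (fun x : X => g⁻¹ • x) ⁻¹' S := by
    ext x; simp [Set.mem_smul_set_iff_inv_smul_mem]
  rw [this]
  exact hmeas _ hS

lemma meas_fsmul (hmeas : ∀ g : G, Measurable (fun x : X => g • x)) (A : Finset G) {S : Set X}
    (hS : MeasurableSet S) : MeasurableSet ((A : Set G) • S) := by
  rw [← Set.iUnion_smul_set]
  exact Finset.measurableSet_biUnion _ fun a _ => meas_smul hmeas a hS

/-- The local push step. -/
lemma push_step (μ : Measure X) [IsFiniteMeasure μ]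
    (hmeas : ∀ g : G, Measurable (fun x : X => g • x))
    (hinv : ∀ (g : G) (S : Set X), MeasurableSet S → μ (g • S) = μ S)
    (A : Finset G) (P R : Set X) (hP : MeasurableSet P) (hR : MeasurableSet R)
    (lam ε : ℝ) (hl : 0 < lam) (hε : 0 ≤ ε)
    (H1 : ∀ T ⊆ (A : Set G) • P \ R, MeasurableSet T →
      lam * μ.real T - ε ≤ μ.real (P ∩ {u | ∃ a ∈ A, a • u ∈ T}))
    (H2 : ∀ T ⊆ (A : Set G) • P \ R, MeasurableSet T →
      μ.real T - ε ≤ lam * μ.real ((A : Set G) • T \ (A : Set G) • R)) :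
    lam * μ.real ((A : Set G) • ((A : Set G) • P) \ (A : Set G) • R) ≤
      μ.real ((A : Set G) • P \ R) + 2 * A.card * ε := by
  classical
  set S : Set X := (A : Set G) • P \ R with hS
  set Sp : Set X := (A : Set G) • ((A : Set G) • P) \ (A : Set G) • R with hSp
  have mS : MeasurableSet S := (meas_fsmul hmeas A hP).diff hR
  have mSp : MeasurableSet Sp :=
    (meas_fsmul hmeas A (meas_fsmul hmeas A hP)).diff (meas_fsmul hmeas A hR)
  have mpre : ∀ (g : G) (T : Set X), MeasurableSet T → MeasurableSet {x | g • x ∈ T} :=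
    fun g T hT => hmeas g hT
  have inv2 : ∀ (g : G) (U V : Set X), MeasurableSet U → MeasurableSet V →
      μ.real (U ∩ {x | g • x ∈ V}) = μ.real (V ∩ {x | g⁻¹ • x ∈ U}) := by
    intro g U V hU hV
    have : V ∩ {x | g⁻¹ • x ∈ U} = g • (U ∩ {x | g • x ∈ V}) := by
      ext x
      simp [Set.mem_smul_set_iff_inv_smul_mem, and_comm]
    rw [this, measureReal_def, measureReal_def, hinv g _ (hU.inter (mpre g V hV))]
  obtain ⟨mp, ep⟩ := layer_sum μ A (fun a => P ∩ {x | a • x ∈ S})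
    (fun a => hP.inter (mpre a S mS))
  obtain ⟨ms, es⟩ := layer_sum μ A (fun a => S ∩ {x | a • x ∈ Sp})
    (fun a => mS.inter (mpre a Sp mSp))
  obtain ⟨ms', es'⟩ := layer_sum μ A (fun a => S ∩ {x | a⁻¹ • x ∈ P})
    (fun a => mS.inter (mpre a⁻¹ P hP))
  obtain ⟨mq, eq⟩ := layer_sum μ A (fun a => Sp ∩ {x | a⁻¹ • x ∈ S})
    (fun a => mSp.inter (mpre a⁻¹ S mS))
  rw [← Finset.sum_congr rfl fun a _ => inv2 a P S hP mS, ← ep] at es'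
  rw [← Finset.sum_congr rfl fun a _ => inv2 a S Sp mS mSp, ← es] at eq
  set p : ℕ → Set X := fun t => {x | ∃ T ⊆ A, T.card = t ∧ ∀ a ∈ T, x ∈ P ∩ {x | a • x ∈ S}}
    with hp
  set s : ℕ → Set X := fun t => {x | ∃ T ⊆ A, T.card = t ∧ ∀ a ∈ T, x ∈ S ∩ {x | a • x ∈ Sp}}
    with hs
  set s' : ℕ → Set X := fun t => {x | ∃ T ⊆ A, T.card = t ∧ ∀ a ∈ T, x ∈ S ∩ {x | a⁻¹ • x ∈ P}}
    with hs'
  set q : ℕ → Set X := fun t => {x | ∃ T ⊆ A, T.card = t ∧ ∀ a ∈ T, x ∈ Sp ∩ {x | a⁻¹ • x ∈ S}}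
    with hq
  have sub : ∀ t, 1 ≤ t → s t ⊆ S := by
    rintro t ht x ⟨T, hT, hc, hx⟩
    obtain ⟨a, ha⟩ := Finset.card_pos.1 (by omega : 0 < T.card)
    exact (hx a ha).1
  have sub' : ∀ t, 1 ≤ t → s' t ⊆ S := by
    rintro t ht x ⟨T, hT, hc, hx⟩
    obtain ⟨a, ha⟩ := Finset.card_pos.1 (by omega : 0 < T.card)
    exact (hx a ha).1
  have smem : ∀ (a : G) (x : X) (U : Set X), a ∈ A → x ∈ U → a • x ∈ (A : Set G) • U :=
    fun a x U ha hx => Set.smul_mem_smul (Finset.mem_coe.2 ha) hx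
  have k1 : ∀ t, 1 ≤ t → lam * μ.real (s t) - ε ≤ μ.real (p t) := by
    intro t ht
    refine (H1 _ (sub t ht) (ms t)).trans (measureReal_mono ?_)
    rintro u ⟨hu, b, hb, T, hT, hc, hx⟩
    refine ⟨T, hT, hc, fun a ha => ⟨hu, ?_⟩⟩
    have h := (hx a ha).2
    refine ⟨smem a u P (hT ha) hu, fun hR' => h.2 ?_⟩
    rw [smul_comm]
    exact smem b _ R hb hR'
  have k2 : ∀ t, 1 ≤ t → μ.real (s' t) - ε ≤ lam * μ.real (q t) := by
    intro t ht
    refine (H2 _ (sub' t ht) (ms' t)).trans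
      (mul_le_mul_of_nonneg_left (measureReal_mono ?_) hl.le)
    rintro w ⟨⟨b, hb, v, ⟨T, hT, hc, hx⟩, rfl⟩, hw⟩
    refine ⟨T, hT, hc, fun a ha => ?_⟩
    have h := hx a ha
    refine ⟨⟨smem b v _ hb h.1.1, hw⟩, ?_⟩
    have h2 : a⁻¹ • v ∈ P := h.2
    show a⁻¹ • b • v ∈ S
    rw [smul_comm]
    refine ⟨smem b _ P hb h2, fun hR' => hw ?_⟩
    have := smem a _ R (hT ha) hR'
    rw [smul_comm b, smul_inv_smul] at this
    exact this
  rcases Nat.eq_zero_or_pos A.card with h0 | h0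
  · have : A = ∅ := Finset.card_eq_zero.1 h0
    have hSe : Sp = ∅ := by rw [hSp, this]; simp
    rw [hSe, h0]
    simp
  have q1 : Sp ⊆ q 1 := by
    rintro w ⟨⟨a, ha, y, hy, rfl⟩, hw⟩
    refine ⟨{a}, by simpa using ha, by simp, ?_⟩
    intro b hb
    rw [Finset.mem_singleton] at hb
    subst hb
    refine ⟨⟨smem _ y _ ha hy, hw⟩, ?_⟩
    show b⁻¹ • b • y ∈ S
    rw [inv_smul_smul]
    exact ⟨hy, fun h => hw (smem b y R ha h)⟩
  have e1 : ∑ t ∈ Finset.Icc 1 A.card, (lam * μ.real (s t) - ε) ≤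
      ∑ t ∈ Finset.Icc 1 A.card, μ.real (p t) :=
    Finset.sum_le_sum fun t ht => k1 t (Finset.mem_Icc.1 ht).1
  rw [Finset.sum_sub_distrib, ← Finset.mul_sum] at e1
  simp only [Finset.sum_const, Nat.card_Icc, nsmul_eq_mul, Nat.add_sub_cancel] at e1
  have e2 : lam * μ.real (q 1) - μ.real (s' 1) + ε ≤
      ∑ t ∈ Finset.Icc 1 A.card, (lam * μ.real (q t) - μ.real (s' t) + ε) :=
    Finset.single_le_sum (f := fun t => lam * μ.real (q t) - μ.real (s' t) + ε)
      (fun t ht => by have := k2 t (Finset.mem_Icc.1 ht).1; show (0 : ℝ) ≤ _; linarith)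
      (Finset.mem_Icc.2 ⟨le_rfl, h0⟩)
  rw [Finset.sum_add_distrib, Finset.sum_sub_distrib, ← Finset.mul_sum] at e2
  simp only [Finset.sum_const, Nat.card_Icc, nsmul_eq_mul, Nat.add_sub_cancel] at e2
  have e3 : μ.real Sp ≤ μ.real (q 1) := measureReal_mono q1
  have e4 : μ.real (s' 1) ≤ μ.real S := measureReal_mono (sub' 1 le_rfl)
  have e5 := mul_le_mul_of_nonneg_left e3 hl.le
  change ∑ t ∈ Finset.Icc 1 A.card, μ.real (q t) = ∑ t ∈ Finset.Icc 1 A.card, μ.real (s t) at eq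
  change ∑ t ∈ Finset.Icc 1 A.card, μ.real (s' t) = ∑ t ∈ Finset.Icc 1 A.card, μ.real (p t) at es'
  rw [eq, es'] at e2
  linarith

/-- the source set of level `l` -/
def srcLevel (A : Finset G) (B : Set X) (R : ℕ → Set X) : ℕ → Set X
  | 0 => B
  | l + 1 => (A : Set G) • R l

/-- The weight of the cut described by `R`. -/
noncomputable def cutW (μ : Measure X) (A : Finset G) (B : Set X) (lam : ℝ) (h : ℕ)
    (R : ℕ → Set X) : ℝ :=
  ∑ l ∈ Finset.range (h + 1), lam ^ l * μ.real (srcLevel A B R l \ R l)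

/-- Admissible cut data. -/
def CutOK (B : Set X) (h : ℕ) (R : ℕ → Set X) : Prop :=
  (∀ l, MeasurableSet (R l)) ∧ R 0 ⊆ B ∧ R h = ∅


lemma srcLevel_update_of_ne (A : Finset G) (B : Set X) (R : ℕ → Set X) (i l : ℕ) (T : Set X)
    (h : l ≠ i + 1) : srcLevel A B (Function.update R i T) l = srcLevel A B R l := by
  cases l with
  | zero => rfl
  | succ l =>
    have : l ≠ i := fun e => h (by rw [e])
    simp [srcLevel, Function.update_of_ne this]

lemma cutW_update (μ : Measure X) (A : Finset G) (B : Set X) (lam : ℝ) (h : ℕ)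
    (R : ℕ → Set X) (i : ℕ) (hi : i < h) (T : Set X) :
    cutW μ A B lam h (Function.update R i T) - cutW μ A B lam h R =
      lam ^ i * (μ.real (srcLevel A B R i \ T) - μ.real (srcLevel A B R i \ R i)) +
      lam ^ (i + 1) * (μ.real ((A : Set G) • T \ R (i + 1)) -
        μ.real ((A : Set G) • R i \ R (i + 1))) := by
  classical
  unfold cutW
  rw [← Finset.sum_sub_distrib]
  rw [← Finset.sum_subset (s₁ := {i, i + 1})]
  · rw [Finset.sum_pair (by omega)]
    rw [srcLevel_update_of_ne _ _ _ _ _ _ (by omega : i ≠ i + 1)]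
    simp only [srcLevel, Function.update_self, Function.update_of_ne (by omega : i + 1 ≠ i)]
    ring
  · intro l hl
    simp only [Finset.mem_insert, Finset.mem_singleton] at hl
    rw [Finset.mem_range]
    omega
  · intro l _ hl
    simp only [Finset.mem_insert, Finset.mem_singleton, not_or] at hl
    rw [srcLevel_update_of_ne _ _ _ _ _ _ hl.2, Function.update_of_ne hl.1, sub_self]

/-- Quantitative Plünnecke inequality in the measure setting. -/
lemma plunnecke_quant (μ : Measure X) [IsFiniteMeasure μ]
    (hmeas : ∀ g : G, Measurable (fun x : X => g • x))
    (hinv : ∀ (g : G) (S : Set X), MeasurableSet S → μ (g • S) = μ S)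
    (A : Finset G) (B : Set X) (hB : MeasurableSet B) (lam : ℝ) (hl : 0 < lam)
    (j h : ℕ) (hj : 0 < j) (hjh : j ≤ h) (η : ℝ) (hη : 0 < η) :
    ∃ Z ⊆ B, MeasurableSet Z ∧
      μ.real (B \ Z) + lam ^ h * μ.real ((A : Set G) ^ h • Z) ≤
        lam ^ j * μ.real ((A : Set G) ^ j • B) + η := by
  classical
  have mpow : ∀ (l : ℕ) (Z : Set X), MeasurableSet Z → MeasurableSet ((A : Set G) ^ l • Z) := by
    intro l Z hZ
    induction l with
    | zero => simpa using hZ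
    | succ l ih => rw [pow_succ', mul_smul]; exact meas_fsmul hmeas A ih
  set W : Set ℝ := {r | ∃ R, CutOK B h R ∧ r = cutW μ A B lam h R} with hW
  have hbdd : BddBelow W := by
    refine ⟨0, ?_⟩
    rintro r ⟨R, _, rfl⟩
    exact Finset.sum_nonneg fun l _ => mul_nonneg (pow_nonneg hl.le _) measureReal_nonneg
  -- the cut at level `j`
  set R0 : ℕ → Set X := fun l => if l < j then (A : Set G) ^ l • B else ∅ with hR0
  have ok0 : CutOK B h R0 := by
    refine ⟨fun l => ?_, ?_, ?_⟩
    · simp only [hR0]; split_ifs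
      · exact mpow l B hB
      · exact MeasurableSet.empty
    · simp [hR0, hj]
    · simp [hR0, hjh]
  have val0 : cutW μ A B lam h R0 = lam ^ j * μ.real ((A : Set G) ^ j • B) := by
    unfold cutW
    rw [Finset.sum_eq_single j]
    · obtain ⟨j', rfl⟩ : ∃ j', j = j' + 1 := ⟨j - 1, by omega⟩
      simp [srcLevel, hR0, pow_succ', mul_smul]
    · intro l _ hlj
      have : srcLevel A B R0 l \ R0 l = ∅ := by
        cases l with
        | zero => simp [srcLevel, hR0, hj]
        | succ l =>
          rcases lt_or_ge (l + 1) j with h1 | h1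
          · simp [srcLevel, hR0, h1, (by omega : l < j), pow_succ', mul_smul]
          · have hlj' : j ≤ l := by omega
            simp [srcLevel, hR0, not_lt.2 hlj']
      simp [this]
    · intro hn
      exact absurd (Finset.mem_range.2 (by omega)) hn
  have hm0 : sInf W ≤ lam ^ j * μ.real ((A : Set G) ^ j • B) := by
    rw [← val0]; exact csInf_le hbdd ⟨R0, ok0, rfl⟩
  have hne : W.Nonempty := ⟨_, R0, ok0, rfl⟩
  have claim : ∀ i : ℕ, i < h → ∀ η : ℝ, 0 < η → ∃ R, CutOK B h R ∧
      (∀ l < i, R (l + 1) = (A : Set G) • R l) ∧ cutW μ A B lam h R ≤ sInf W + η := by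
    intro i
    induction i with
    | zero =>
      intro _ η hη
      obtain ⟨r, ⟨R, hR, rfl⟩, hr⟩ := exists_lt_of_csInf_lt hne (lt_add_of_pos_right (sInf W) hη)
      exact ⟨R, hR, fun l hl => absurd hl (by omega), hr.le⟩
    | succ i ih =>
      intro hi η hη
      have hli : 0 < lam ^ i := pow_pos hl _
      have hli1 : 0 < lam ^ (i + 1) := pow_pos hl _
      obtain ⟨ε, hε, hεη⟩ : ∃ ε : ℝ, 0 < ε ∧ lam ^ (i + 1) * (2 * A.card * ε) ≤ η / 2 := by
        refine ⟨η / 2 / (lam ^ (i + 1) * (2 * A.card + 1)), by positivity, ?_⟩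
        have : lam ^ (i + 1) * (2 * A.card * (η / 2 / (lam ^ (i + 1) * (2 * A.card + 1)))) =
            (η / 2) * ((2 * A.card) / (2 * A.card + 1)) := by field_simp
        rw [this]
        refine mul_le_of_le_one_right (by positivity) ?_
        rw [div_le_one (by positivity)]
        linarith
      obtain ⟨R, hR, hpre, hcut⟩ := ih (by omega)
        (min (η / 2) (min (lam ^ i * ε) (lam ^ (i + 1) * ε)))
        (lt_min (by positivity) (lt_min (by positivity) (by positivity)))
      have c1 : cutW μ A B lam h R ≤ sInf W + η / 2 :=
        hcut.trans (add_le_add le_rfl (min_le_left _ _))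
      have c2 : cutW μ A B lam h R ≤ sInf W + lam ^ i * ε :=
        hcut.trans (add_le_add le_rfl ((min_le_right _ _).trans (min_le_left _ _)))
      have c3 : cutW μ A B lam h R ≤ sInf W + lam ^ (i + 1) * ε :=
        hcut.trans (add_le_add le_rfl ((min_le_right _ _).trans (min_le_right _ _)))
      have okup : ∀ (n : ℕ) (T : Set X), n < h → MeasurableSet T → (n = 0 → T ⊆ B) →
          CutOK B h (Function.update R n T) := by
        intro n T hn hT h0
        refine ⟨fun l => ?_, ?_, ?_⟩
        · rcases eq_or_ne l n with rfl | hne'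
          · simpa using hT
          · rw [Function.update_of_ne hne']; exact hR.1 l
        · rcases eq_or_ne 0 n with rfl | hne'
          · simpa using h0 rfl
          · rw [Function.update_of_ne hne']; exact hR.2.1
        · rw [Function.update_of_ne (by omega)]; exact hR.2.2
      have mA := fun (S : Set X) (hS : MeasurableSet S) => meas_fsmul hmeas A hS
      have key := push_step μ hmeas hinv A (R i) (R (i + 1)) (hR.1 _) (hR.1 _) lam ε hl hε.le
        ?_ ?_
      · refine ⟨Function.update R (i + 1) ((A : Set G) • R i),
          okup _ _ hi (mA _ (hR.1 i)) (by omega), ?_, ?_⟩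
        · intro l hl'
          rcases eq_or_ne l i with rfl | hne'
          · simp
          · rw [Function.update_of_ne (by omega), Function.update_of_ne (by omega)]
            exact hpre l (by omega)
        · have e := cutW_update μ A B lam h R (i + 1) hi ((A : Set G) • R i)
          have s1 : μ.real ((A : Set G) • ((A : Set G) • R i) \ R (i + 1 + 1)) ≤
              μ.real ((A : Set G) • R (i + 1) \ R (i + 1 + 1)) +
              μ.real ((A : Set G) • ((A : Set G) • R i) \ (A : Set G) • R (i + 1)) := by
            refine (measureReal_mono ?_).trans (measureReal_union_le _ _)
            intro x hx
            by_cases hx' : x ∈ (A : Set G) • R (i + 1)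
            · exact Or.inl ⟨hx', hx.2⟩
            · exact Or.inr ⟨hx.1, hx'⟩
          simp only [srcLevel, Set.diff_self, measureReal_empty] at e
          have s2 := mul_le_mul_of_nonneg_left s1 (pow_pos hl (i + 1 + 1)).le
          have s3 := mul_le_mul_of_nonneg_left key hli1.le
          have s4 : lam ^ (i + 1 + 1) = lam ^ (i + 1) * lam := pow_succ _ _
          rw [s4] at s2 e
          linarith
      · intro T hT mT
        set N : Set X := {u | ∃ a ∈ A, a • u ∈ T} with hN
        have mN : MeasurableSet N := by
          have : N = ⋃ a ∈ A, (fun x : X => a • x) ⁻¹' T := by ext x; simp [hN]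
          rw [this]
          exact Finset.measurableSet_biUnion _ fun a _ => hmeas a mT
        have okn := okup i (R i \ N) (by omega) ((hR.1 i).diff mN)
          (fun h0 => by subst h0; exact Set.diff_subset.trans hR.2.1)
        have lo := csInf_le hbdd ⟨_, okn, rfl⟩
        have e := cutW_update μ A B lam h R i (by omega) (R i \ N)
        have s1 : μ.real (srcLevel A B R i \ (R i \ N)) ≤
            μ.real (srcLevel A B R i \ R i) + μ.real (R i ∩ N) := by
          refine (measureReal_mono ?_).trans (measureReal_union_le _ _)
          intro x hx
          by_cases hx' : x ∈ R i
          · exact Or.inr ⟨hx', by by_contra hc; exact hx.2 ⟨hx', hc⟩⟩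
          · exact Or.inl ⟨hx.1, hx'⟩
        have s2 : μ.real ((A : Set G) • (R i \ N) \ R (i + 1)) ≤
            μ.real ((A : Set G) • R i \ R (i + 1)) - μ.real T := by
          rw [← measureReal_diff hT mT]
          refine measureReal_mono ?_
          rintro x ⟨⟨a, ha, y, hy, rfl⟩, hx⟩
          exact ⟨⟨Set.smul_mem_smul ha hy.1, hx⟩, fun hxT => hy.2 ⟨a, ha, hxT⟩⟩
        have s3 := mul_le_mul_of_nonneg_left s1 hli.le
        have s4 := mul_le_mul_of_nonneg_left s2 hli1.le
        have s5 : lam ^ (i + 1) = lam ^ i * lam := pow_succ _ _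
        rw [s5] at s4 e
        refine le_of_mul_le_mul_left ?_ hli
        linarith
      · intro T hT mT
        have okn := okup (i + 1) (R (i + 1) ∪ T) hi ((hR.1 _).union mT) (by omega)
        have lo := csInf_le hbdd ⟨_, okn, rfl⟩
        have e := cutW_update μ A B lam h R (i + 1) hi (R (i + 1) ∪ T)
        simp only [srcLevel] at e
        have s1 : μ.real ((A : Set G) • R i \ (R (i + 1) ∪ T)) =
            μ.real ((A : Set G) • R i \ R (i + 1)) - μ.real T := by
          rw [← measureReal_diff hT mT, Set.diff_diff]
        have s2 : μ.real ((A : Set G) • (R (i + 1) ∪ T) \ R (i + 1 + 1)) ≤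
            μ.real ((A : Set G) • R (i + 1) \ R (i + 1 + 1)) +
            μ.real ((A : Set G) • T \ (A : Set G) • R (i + 1)) := by
          refine (measureReal_mono ?_).trans (measureReal_union_le _ _)
          rw [Set.smul_union]
          rintro x ⟨hx, hx2⟩
          by_cases hx' : x ∈ (A : Set G) • R (i + 1)
          · exact Or.inl ⟨hx', hx2⟩
          · exact Or.inr ⟨hx.resolve_left hx', hx'⟩
        rw [s1] at e
        have s3 := mul_le_mul_of_nonneg_left s2 (pow_pos hl (i + 1 + 1)).le
        have s5 : lam ^ (i + 1 + 1) = lam ^ (i + 1) * lam := pow_succ _ _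
        rw [s5] at s3 e
        refine le_of_mul_le_mul_left ?_ hli1
        linarith
  obtain ⟨h', rfl⟩ : ∃ h', h = h' + 1 := ⟨h - 1, by omega⟩
  obtain ⟨R, hR, hpre, hcut⟩ := claim h' (by omega) η hη
  have hpow : ∀ l ≤ h', R l = (A : Set G) ^ l • R 0 := by
    intro l
    induction l with
    | zero => intro _; simp
    | succ l ih =>
      intro hl'
      rw [hpre l (by omega), ih (by omega), pow_succ', mul_smul]
  refine ⟨R 0, hR.2.1, hR.1 0, ?_⟩
  refine le_trans ?_ (hcut.trans (add_le_add hm0 le_rfl))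
  unfold cutW
  have hsub : ({0, h' + 1} : Finset ℕ) ⊆ Finset.range (h' + 1 + 1) := by
    intro l hl'
    simp only [Finset.mem_insert, Finset.mem_singleton] at hl'
    rw [Finset.mem_range]; omega
  refine le_trans (le_of_eq ?_) (Finset.sum_le_sum_of_subset_of_nonneg hsub fun l _ _ =>
    mul_nonneg (pow_nonneg hl.le _) measureReal_nonneg)
  rw [Finset.sum_pair (by omega), hR.2.2]
  simp only [srcLevel, pow_zero, one_mul, Set.diff_empty]
  rw [hpow h' le_rfl, ← mul_smul, ← pow_succ']

lemma exists_finite_pow (A : Set G) (k : ℕ) (A' : Set G) (hA' : A' ⊆ A ^ k) (hf : A'.Finite) :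
    ∃ F : Finset G, (F : Set G) ⊆ A ∧ A' ⊆ (F : Set G) ^ k := by
  classical
  have one : ∀ (k : ℕ) (g : G), g ∈ A ^ k →
      ∃ F : Finset G, (F : Set G) ⊆ A ∧ g ∈ (F : Set G) ^ k := by
    intro k
    induction k with
    | zero => intro g hg; exact ⟨∅, by simp, by simpa using hg⟩
    | succ k ih =>
      intro g hg
      rw [pow_succ] at hg
      obtain ⟨x, hx, a, ha, rfl⟩ := hg
      obtain ⟨F, hF, hxF⟩ := ih x hx
      refine ⟨insert a F, ?_, ?_⟩
      · rw [Finset.coe_insert]; exact Set.insert_subset ha hF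
      · rw [pow_succ]
        refine Set.mul_mem_mul (Set.pow_subset_pow_left ?_ hxF) (by simp)
        simp
  choose! F hF hF' using one k
  refine ⟨hf.toFinset.biUnion F, ?_, ?_⟩
  · intro x hx
    simp only [Finset.coe_biUnion, Set.mem_iUnion, Set.Finite.coe_toFinset] at hx
    obtain ⟨g, hg, hx⟩ := hx
    exact hF g (hA' hg) hx
  · intro g hg
    refine Set.pow_subset_pow_left ?_ (hF' g (hA' hg))
    intro x hx
    simp only [Finset.coe_biUnion, Set.mem_iUnion, Set.Finite.coe_toFinset]
    exact ⟨g, hg, hx⟩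

end Helpers

/-- If a countable abelian group `G` acts on a probability space `(X, 𝓑, μ)` by measure
preserving maps, `A ⊆ G` is any subset, `B` is measurable with `μ(B) > 0`, `0 < δ < 1` and
`j ≤ k` are positive integers, then
`sup { c_δ(A', B)^(1/k) : A' ⊆ A^k finite } ≤ (1-δ)^(-1/j) (μ(A^j B)/μ(B))^(1/j)`. -/
theorem sSup_magRatioHeavy_finite_subsets_le {G X : Type*} [CommGroup G] [Countable G]
    [MulAction G X] [MeasurableSpace X] (μ : Measure X) [IsProbabilityMeasure μ]
    (hmeas : ∀ g : G, Measurable (fun x : X => g • x))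
    (hinv : ∀ (g : G) (S : Set X), MeasurableSet S → μ (g • S) = μ S)
    (A : Set G) (B : Set X) (hB : MeasurableSet B) (hB0 : 0 < μ B)
    (δ : ℝ) (hδ0 : 0 < δ) (hδ1 : δ < 1) (j k : ℕ) (hj : 0 < j) (hjk : j ≤ k) :
    sSup {r : ℝ≥0∞ | ∃ A' : Set G, A' ⊆ A ^ k ∧ A'.Finite ∧
        r = magRatioHeavy μ δ A' B ^ (1 / (k : ℝ))} ≤
      ENNReal.ofReal ((1 - δ) ^ (-(1 / (j : ℝ)))) *
        (μ ((A ^ j) • B) / μ B) ^ (1 / (j : ℝ)) := by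
  classical
  refine sSup_le ?_
  rintro r ⟨A', hA', hf, rfl⟩
  obtain ⟨F, hFA, hF⟩ := exists_finite_pow A k A' hA' hf
  have hk : 0 < k := lt_of_lt_of_le hj hjk
  have hb : 0 < μ.real B := by
    rw [measureReal_def]; exact ENNReal.toReal_pos hB0.ne' (measure_ne_top _ _)
  have h1δ : 0 < 1 - δ := by linarith
  set ρ : ℝ := μ.real ((A ^ j) • B) / μ.real B with hρ
  have hρ0 : 0 ≤ ρ := div_nonneg measureReal_nonneg measureReal_nonneg
  have hratio : μ ((A ^ j) • B) / μ B = ENNReal.ofReal ρ := by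
    rw [hρ, ENNReal.ofReal_div_of_pos hb, ofReal_measureReal, ofReal_measureReal]
  have hj0 : (0 : ℝ) < j := by exact_mod_cast hj
  have hk0 : (0 : ℝ) < k := by exact_mod_cast hk
  set x : ℝ := (1 - δ) ^ (-(1 / (j : ℝ))) * ρ ^ (1 / (j : ℝ)) with hx
  have hx0 : 0 ≤ x := mul_nonneg (Real.rpow_nonneg h1δ.le _) (Real.rpow_nonneg hρ0 _)
  have hxj : x ^ j = (1 - δ)⁻¹ * ρ := by
    rw [hx, mul_pow, ← Real.rpow_natCast, ← Real.rpow_natCast, ← Real.rpow_mul h1δ.le,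
      ← Real.rpow_mul hρ0]
    have e1 : -(1 / (j : ℝ)) * j = -1 := by field_simp
    have e2 : 1 / (j : ℝ) * j = 1 := by field_simp
    rw [e1, e2, Real.rpow_one, Real.rpow_neg_one]
  have hrhs : ENNReal.ofReal ((1 - δ) ^ (-(1 / (j : ℝ)))) *
        (μ ((A ^ j) • B) / μ B) ^ (1 / (j : ℝ)) = ENNReal.ofReal x := by
    rw [hratio, ENNReal.ofReal_rpow_of_nonneg hρ0 (by positivity),
      ← ENNReal.ofReal_mul (Real.rpow_nonneg h1δ.le _)]
  rw [hrhs]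
  refine le_of_forall_gt_imp_ge_of_dense fun c hc => ?_
  rcases eq_or_ne c ⊤ with rfl | hct
  · exact le_top
  obtain ⟨C, hC0, rfl⟩ : ∃ C : ℝ, 0 ≤ C ∧ c = ENNReal.ofReal C :=
    ⟨c.toReal, ENNReal.toReal_nonneg, (ENNReal.ofReal_toReal hct).symm⟩
  have hxC : x < C := (ENNReal.ofReal_lt_ofReal_iff_of_nonneg hx0).1 hc
  have hC : 0 < C := lt_of_le_of_lt hx0 hxC
  have hpow : x ^ j < C ^ j := pow_lt_pow_left₀ hxC hx0 hj.ne'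
  have hCj : 0 < C ^ j := pow_pos hC j
  have hCk : 0 < C ^ k := pow_pos hC k
  have hlt : (C⁻¹) ^ j * μ.real ((A ^ j) • B) < (1 - δ) * μ.real B := by
    rw [hxj, inv_mul_lt_iff₀ h1δ, hρ, div_lt_iff₀ hb] at hpow
    rw [inv_pow, inv_mul_lt_iff₀ hCj]
    linarith
  obtain ⟨Z, hZB, hZm, hZ⟩ := plunnecke_quant μ hmeas hinv F B hB C⁻¹ (inv_pos.2 hC) j k hj hjk
    ((1 - δ) * μ.real B - (C⁻¹) ^ j * μ.real ((A ^ j) • B)) (by linarith)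
  have hmono : μ.real ((F : Set G) ^ j • B) ≤ μ.real ((A ^ j) • B) :=
    measureReal_mono (Set.smul_subset_smul_right (Set.pow_subset_pow_left hFA))
  have hmono' := mul_le_mul_of_nonneg_left hmono (pow_nonneg (inv_pos.2 hC).le j)
  rw [measureReal_diff hZB hZm] at hZ
  have hmain : δ * μ.real B + (C⁻¹) ^ k * μ.real ((F : Set G) ^ k • Z) ≤ μ.real Z := by linarith
  have hnn : 0 ≤ (C⁻¹) ^ k * μ.real ((F : Set G) ^ k • Z) :=
    mul_nonneg (pow_nonneg (inv_pos.2 hC).le k) measureReal_nonneg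
  have hZ1 : δ * μ.real B ≤ μ.real Z := by linarith
  have hδb : 0 < δ * μ.real B := mul_pos hδ0 hb
  have hZpos : 0 < μ.real Z := by linarith
  have hZ2 : μ.real ((F : Set G) ^ k • Z) ≤ C ^ k * μ.real Z := by
    have : (C⁻¹) ^ k * μ.real ((F : Set G) ^ k • Z) ≤ μ.real Z := by linarith
    rwa [inv_pow, inv_mul_le_iff₀ hCk] at this
  have hZ3 : μ.real (A' • Z) ≤ C ^ k * μ.real Z :=
    (measureReal_mono (Set.smul_subset_smul_right hF)).trans hZ2
  have hmag : magRatioHeavy μ δ A' B ≤ ENNReal.ofReal (C ^ k) := by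
    unfold magRatioHeavy
    refine sInf_le_of_le (b := μ (A' • Z) / μ Z) ⟨Z, hZB, hZm, ?_, rfl⟩ ?_
    · rw [← ofReal_measureReal (μ := μ) (s := B), ← ofReal_measureReal (μ := μ) (s := Z),
        ← ENNReal.ofReal_mul hδ0.le]
      exact ENNReal.ofReal_le_ofReal hZ1
    · rw [← ofReal_measureReal (μ := μ) (s := A' • Z), ← ofReal_measureReal (μ := μ) (s := Z),
        ← ENNReal.ofReal_div_of_pos hZpos]
      refine ENNReal.ofReal_le_ofReal ?_
      rwa [div_le_iff₀ hZpos]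
  refine (ENNReal.rpow_le_rpow hmag (by positivity)).trans (le_of_eq ?_)
  rw [ENNReal.ofReal_rpow_of_nonneg hCk.le (by positivity), ← Real.rpow_natCast,
    ← Real.rpow_mul hC.le]
  have e2 : (k : ℝ) * (1 / (k : ℝ)) = 1 := by field_simp
  rw [e2, Real.rpow_one]
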